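/- Let α be a type, I ⊆ α a Herbrand interpretation, and Bodies : α → Set (Set (α × Bool)) assign to each atom the set of bodies of the ground rules with that atom as head. Suppose I is supported: for every a ∈ I there exists B ∈ Bodies(a) such that I satisfies B. Let Q be a set of literals satisfied by I, and define the iterated regression by Q₀ = Q and Q_{k+1} = Q_k ∪ ⋃ { ⋂ Bodies(a) | (a, true) ∈ Q_k }. Then for every natural number k, the interpretation I satisfies Q_k; in particular I satisfies the fixpoint reg_P(Q) of the one-step regression starting from Q. -/

import Mathlib

/-- `I` satisfies the literal `l = (a, b)`: `a ∈ I` if `b = true`, `a ∉ I` if `b = false`. -/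
def SatLit {α : Type*} (I : Set α) (l : α × Bool) : Prop :=
  if l.2 then l.1 ∈ I else l.1 ∉ I

/-- `I` satisfies a body `B` (a set of literals) iff it satisfies every literal in it. -/
def SatBody {α : Type*} (I : Set α) (B : Set (α × Bool)) : Prop :=
  ∀ l ∈ B, SatLit I l

theorem iterated_regression_sound {α : Type*} (I : Set α)
    (Bodies : α → Set (Set (α × Bool)))
    (hsupp : ∀ a ∈ I, ∃ B ∈ Bodies a, SatBody I B)
    (Q : Set (α × Bool)) (hQ : SatBody I Q)
    (Qseq : ℕ → Set (α × Bool))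
    (h0 : Qseq 0 = Q)
    (hstep : ∀ k, Qseq (k + 1) =
      Qseq k ∪ {l | ∃ a, (a, true) ∈ Qseq k ∧ l ∈ ⋂₀ Bodies a}) :
    (∀ k, SatBody I (Qseq k)) ∧ SatBody I (⋃ k, Qseq k) := by
  have hk : ∀ k, SatBody I (Qseq k) := by
    intro k
    induction k with
    | zero => rwa [h0]
    | succ k ih =>
      rw [hstep]
      rintro l (hl | ⟨a, ha, hl⟩)
      · exact ih l hl
      · have haI : a ∈ I := by simpa [SatLit] using ih (a, true) ha
        obtain ⟨B, hB, hIB⟩ := hsupp a haI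
        exact hIB l (hl B hB)
  refine ⟨hk, fun l hl => ?_⟩
  obtain ⟨k, hlk⟩ := Set.mem_iUnion.mp hl
  exact hk k l hlk
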